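/- Let F : ℝ^n → ℝ^n be a piecewise affine function that is nonsingular at infinity with respect to a corresponding polyhedral subdivision 𝒫(F). Then for any two regular values y, y' of F, the signed preimage counts agree: Σ_{x ∈ F⁻¹(y)} sign(det D_xF) = Σ_{x ∈ F⁻¹(y')} sign(det D_xF) (both sums being finite). In other words, the mapping degree of F is globally defined, independent of the regular value. -/

import Mathlib

open Set Filter Bornology

noncomputable section

/-- A (closed convex) polyhedron in `ℝⁿ`: a finite intersection of closed halfspaces. -/
def IsPolyhedron {n : ℕ} (P : Set (Fin n → ℝ)) : Prop :=
  ∃ (m : ℕ) (a : Fin m → (Fin n → ℝ)) (c : Fin m → ℝ),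
    P = {x | ∀ i, (∑ j, a i j * x j) ≤ c i}

/-- `G` is a proper face of the polyhedron `P`: `G ≠ P` and `G` is either empty or the
intersection of `P` with a supporting hyperplane. -/
def IsProperFaceOf {n : ℕ} (G P : Set (Fin n → ℝ)) : Prop :=
  G ≠ P ∧ (G = ∅ ∨ ∃ (a : Fin n → ℝ) (c : ℝ),
    (∀ x ∈ P, (∑ j, a j * x j) ≤ c) ∧ G = {x ∈ P | (∑ j, a j * x j) = c})

/-- The affine map `x ↦ A x + b` encoded by the pair `p = (A, b)`. -/
def affMap {n : ℕ} (p : Matrix (Fin n) (Fin n) ℝ × (Fin n → ℝ)) :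
    (Fin n → ℝ) → (Fin n → ℝ) :=
  fun x => p.1.mulVec x + p.2

/-- The selection function `p` is active (for `F`) on the set `U`. -/
def ActiveOn {n : ℕ} (F : (Fin n → ℝ) → (Fin n → ℝ))
    (p : Matrix (Fin n) (Fin n) ℝ × (Fin n → ℝ)) (U : Set (Fin n → ℝ)) : Prop :=
  ∀ x ∈ U, F x = affMap p x

/-- `F` is piecewise affine with (finite) set of selection functions `S`. -/
def IsPWA {n : ℕ} (F : (Fin n → ℝ) → (Fin n → ℝ))
    (S : Finset (Matrix (Fin n) (Fin n) ℝ × (Fin n → ℝ))) : Prop :=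
  Continuous F ∧ ∀ x, ∃ p ∈ S, F x = affMap p x

/-- `𝒞` is a polyhedral subdivision of `ℝⁿ` corresponding to the piecewise affine `F`
with selection functions `S`. -/
def IsSubdivision {n : ℕ} (F : (Fin n → ℝ) → (Fin n → ℝ))
    (S : Finset (Matrix (Fin n) (Fin n) ℝ × (Fin n → ℝ)))
    (𝒞 : Set (Set (Fin n → ℝ))) : Prop :=
  𝒞.Finite ∧
  (∀ P ∈ 𝒞, IsPolyhedron P ∧ (interior P).Nonempty) ∧
  ⋃₀ 𝒞 = univ ∧
  (∀ P ∈ 𝒞, ∃ p ∈ S, ActiveOn F p P) ∧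
  (∀ P ∈ 𝒞, ∀ Q ∈ 𝒞, P ≠ Q →
    P ∩ Q = ∅ ∨ (IsProperFaceOf (P ∩ Q) P ∧ IsProperFaceOf (P ∩ Q) Q))

/-- `F` is nonsingular at infinity w.r.t. the subdivision `𝒞`: every selection function
active on an unbounded polyhedron of `𝒞` has invertible linear part. -/
def NonsingularAtInfinity {n : ℕ} (F : (Fin n → ℝ) → (Fin n → ℝ))
    (S : Finset (Matrix (Fin n) (Fin n) ℝ × (Fin n → ℝ)))
    (𝒞 : Set (Set (Fin n → ℝ))) : Prop :=
  ∀ p ∈ S, ∀ P ∈ 𝒞, ¬ IsBounded P → ActiveOn F p P → p.1.det ≠ 0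

/-- `y` is a regular value of `F`. -/
def IsRegularValue {n : ℕ} (F : (Fin n → ℝ) → (Fin n → ℝ)) (y : Fin n → ℝ) : Prop :=
  ∀ x, F x = y → DifferentiableAt ℝ F x ∧ (fderiv ℝ F x).det ≠ 0

/-- The signed count of preimages of `y` under `F`. -/
def degSum {n : ℕ} (F : (Fin n → ℝ) → (Fin n → ℝ)) (y : Fin n → ℝ) : ℝ :=
  ∑ᶠ x ∈ F ⁻¹' {y}, Real.sign ((fderiv ℝ F x).det)

open MeasureTheory Topology

/-- The antisymmetrised divergence of a product of partial derivatives vanishes. -/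
lemma sum_sign_mul_fderiv_prod_fderiv_eq_zero {ι : Type*} [Fintype ι] [DecidableEq ι]
    (f : ι → (ι → ℝ) → ℝ) (hf : ∀ i, ContDiff ℝ 2 (f i)) (k : ι) (x : ι → ℝ) :
    ∑ σ : Equiv.Perm ι, ((Equiv.Perm.sign σ : ℤ) : ℝ) *
      fderiv ℝ (fun z => ∏ i ∈ Finset.univ.erase k, fderiv ℝ (f i) z (Pi.single (σ i) 1)) x
        (Pi.single (σ k) 1) = 0 := by
  have hd : ∀ i, DifferentiableAt ℝ (fderiv ℝ (f i)) x := fun i =>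
    ((hf i).fderiv_right (m := 1) (by norm_num)).differentiable (by norm_num) x
  have hprod : ∀ σ : Equiv.Perm ι,
      fderiv ℝ (fun z => ∏ i ∈ Finset.univ.erase k, fderiv ℝ (f i) z (Pi.single (σ i) 1)) x
        (Pi.single (σ k) 1) = ∑ i ∈ Finset.univ.erase k,
          (∏ j ∈ (Finset.univ.erase k).erase i, fderiv ℝ (f j) x (Pi.single (σ j) 1)) *
            fderiv ℝ (fderiv ℝ (f i)) x (Pi.single (σ k) 1) (Pi.single (σ i) 1) := by
    intro σ
    have := HasFDerivAt.finsetProd (u := Finset.univ.erase k) (x := x)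
      (g := fun i z => fderiv ℝ (f i) z (Pi.single (σ i) 1))
      (fun i _ => (hd i).hasFDerivAt.clm_apply
        (hasFDerivAt_const (𝕜 := ℝ) (Pi.single (σ i) 1 : ι → ℝ) x))
    rw [this.fderiv]
    simp
  simp_rw [hprod, Finset.mul_sum]
  rw [Finset.sum_comm]
  refine Finset.sum_eq_zero fun i hi => ?_
  have hik : i ≠ k := Finset.ne_of_mem_erase hi
  refine Finset.sum_involution (fun σ _ => σ * Equiv.swap k i) ?_ ?_ ?_ ?_
  · intro σ _
    have hsymm := ((hf i).contDiffAt (x := x)).isSymmSndFDerivAt (by simp)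
    have h1 : ∏ j ∈ (Finset.univ.erase k).erase i,
        fderiv ℝ (f j) x (Pi.single ((σ * Equiv.swap k i) j) 1) =
        ∏ j ∈ (Finset.univ.erase k).erase i, fderiv ℝ (f j) x (Pi.single (σ j) 1) := by
      refine Finset.prod_congr rfl fun j hj => ?_
      simp only [Finset.mem_erase] at hj
      rw [Equiv.Perm.mul_apply, Equiv.swap_apply_of_ne_of_ne hj.2.1 hj.1]
    rw [h1, hsymm.eq (Pi.single (σ k) 1) (Pi.single (σ i) 1)]
    simp [Equiv.Perm.sign_swap hik.symm]
  · intro σ _ _ h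
    have := congrArg (fun τ => (σ⁻¹ * τ) k) h
    simp [hik] at this
  · simp
  · intro σ _
    simp [mul_assoc]

/-- The integral of a Jacobian determinant vanishes if one component has compact support. -/
lemma integral_det_fderiv_eq_zero {ι : Type*} [Fintype ι] [DecidableEq ι]
    (f : ι → (ι → ℝ) → ℝ) (hf : ∀ i, ContDiff ℝ 2 (f i)) (k : ι)
    (hk : HasCompactSupport (f k)) :
    ∫ x, (Matrix.of fun i j => fderiv ℝ (f i) x (Pi.single j 1)).det = 0 := by
  have hd : ∀ i v, ContDiff ℝ 1 (fun z => fderiv ℝ (f i) z v) := fun i v =>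
    ((hf i).fderiv_right (m := 1) (by norm_num)).clm_apply contDiff_const
  set P : Equiv.Perm ι → (ι → ℝ) → ℝ := fun σ z =>
    ∏ i ∈ Finset.univ.erase k, fderiv ℝ (f i) z (Pi.single (σ i) 1) with hP
  have hPd : ∀ σ, ContDiff ℝ 1 (P σ) := fun σ => contDiff_prod fun i _ => hd i _
  have hdet : ∀ x, (Matrix.of fun i j => fderiv ℝ (f i) x (Pi.single j 1)).det =
      ∑ σ : Equiv.Perm ι, ((Equiv.Perm.sign σ : ℤ) : ℝ) *
        (P σ x * fderiv ℝ (f k) x (Pi.single (σ k) 1)) := by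
    intro x
    rw [← Matrix.det_transpose, Matrix.det_apply']
    refine Finset.sum_congr rfl fun σ _ => ?_
    simp only [Matrix.transpose_apply, Matrix.of_apply, hP]
    rw [Finset.prod_erase_mul _ _ (Finset.mem_univ k)]
  have hPc : ∀ σ, Continuous (P σ) := fun σ => (hPd σ).continuous
  have hP'c : ∀ σ v, Continuous (fun x => fderiv ℝ (P σ) x v) := fun σ v =>
    ((hPd σ).continuous_fderiv (by norm_num)).clm_apply continuous_const
  have hI1 : ∀ σ v, Integrable (fun x => P σ x * fderiv ℝ (f k) x v) := fun σ v =>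
    ((hPc σ).mul (hd k v).continuous).integrable_of_hasCompactSupport
      ((hk.fderiv_apply ℝ v).mul_left)
  have hI2 : ∀ σ v, Integrable (fun x => fderiv ℝ (P σ) x v * f k x) := fun σ v =>
    ((hP'c σ v).mul (hf k).continuous).integrable_of_hasCompactSupport hk.mul_left
  have hI3 : ∀ σ, Integrable (fun x => P σ x * f k x) := fun σ =>
    ((hPc σ).mul (hf k).continuous).integrable_of_hasCompactSupport hk.mul_left
  simp_rw [hdet]
  rw [integral_finsetSum _ fun σ _ => (hI1 σ _).const_mul _]
  have hparts : ∀ σ v, ∫ x, P σ x * fderiv ℝ (f k) x v = - ∫ x, fderiv ℝ (P σ) x v * f k x :=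
    fun σ v => integral_mul_fderiv_eq_neg_fderiv_mul_of_integrable (hI2 σ v) (hI1 σ v) (hI3 σ)
      (fun x _ => (hPd σ).differentiable (by norm_num) x)
      (fun x _ => (hf k).differentiable (by norm_num) x)
  simp_rw [integral_const_mul, hparts, mul_neg, Finset.sum_neg_distrib, neg_eq_zero,
    ← integral_const_mul]
  rw [← integral_finsetSum _ fun σ _ => (hI2 σ _).const_mul _]
  simp_rw [← mul_assoc, ← Finset.sum_mul]
  simp only [hP, sum_sign_mul_fderiv_prod_fderiv_eq_zero f hf k, zero_mul, integral_zero]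

/-- The determinant of an endomorphism of `ι → ℝ` in coordinates. -/
lemma ContinuousLinearMap.det_eq_det_of_apply_single {ι : Type*} [Fintype ι] [DecidableEq ι] (A : (ι → ℝ) →L[ℝ] (ι → ℝ)) :
    A.det = (Matrix.of fun i j => A (Pi.single j 1) i).det := by
  rw [ContinuousLinearMap.det, ← LinearMap.det_toMatrix']
  rfl

lemma integral_fderiv_mul_det_fderiv_eq_zero_of_contDiff {ι : Type*} [Fintype ι]
    (G : (ι → ℝ) → (ι → ℝ)) (hG : ContDiff ℝ 2 G) (φ : (ι → ℝ) → ℝ) (hφ : ContDiff ℝ 2 φ)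
    (hc : IsCompact (G ⁻¹' tsupport φ)) (w : ι → ℝ) :
    ∫ x, fderiv ℝ φ (G x) w * (fderiv ℝ G x).det = 0 := by
  classical
  have hGi : ∀ i, ContDiff ℝ 2 (fun x => G x i) := fun i => contDiff_pi.1 hG i
  have hentry : ∀ x v i, fderiv ℝ (fun x => G x i) x v = fderiv ℝ G x v i := by
    intro x v i
    have := hasFDerivAt_pi'.1 (hG.differentiable (by norm_num) x).hasFDerivAt i
    rw [this.fderiv]
    rfl
  set f : ι → ι → (ι → ℝ) → ℝ := fun k => Function.update (fun i x => G x i) k (φ ∘ G) with hf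
  have hfd : ∀ k i, ContDiff ℝ 2 (f k i) := by
    intro k i
    by_cases h : i = k
    · subst h
      simpa [hf] using hφ.comp hG
    · simpa [hf, h] using hGi i
  have hdet : ∀ k x, (Matrix.of fun i j => fderiv ℝ (f k i) x (Pi.single j 1)).det =
      fderiv ℝ φ (G x) (Pi.single k 1) * (fderiv ℝ G x).det := by
    intro k x
    rw [ContinuousLinearMap.det_eq_det_of_apply_single, ← smul_eq_mul,
      ← Matrix.det_updateRow_sum _ k fun i => fderiv ℝ φ (G x) (Pi.single i 1)]
    congr 1
    ext i j
    by_cases h : i = k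
    · subst h
      have hcomp : fderiv ℝ (φ ∘ G) x = (fderiv ℝ φ (G x)).comp (fderiv ℝ G x) :=
        fderiv_comp x (hφ.differentiable (by norm_num) _) (hG.differentiable (by norm_num) x)
      simp only [hf, Matrix.of_apply, Function.update_self, Matrix.updateRow_self, hcomp,
        ContinuousLinearMap.comp_apply, Finset.sum_apply, Pi.smul_apply, smul_eq_mul]
      conv_lhs => rw [← Finset.univ_sum_single (fderiv ℝ G x (Pi.single j 1)), map_sum]
      refine Finset.sum_congr rfl fun l _ => ?_
      have : (Pi.single l (fderiv ℝ G x (Pi.single j 1) l) : ι → ℝ) =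
          (fderiv ℝ G x (Pi.single j 1) l) • Pi.single l (1 : ℝ) := by
        rw [← Pi.single_smul]; simp
      rw [this, map_smul, smul_eq_mul, mul_comm]
    · simp [hf, h, hentry]
  have hcomp : HasCompactSupport (φ ∘ G) :=
    HasCompactSupport.intro hc fun x hx =>
      image_eq_zero_of_notMem_tsupport (f := φ) hx
  have hzero : ∀ k, ∫ x, fderiv ℝ φ (G x) (Pi.single k 1) * (fderiv ℝ G x).det = 0 := by
    intro k
    simp_rw [← hdet k]
    exact integral_det_fderiv_eq_zero (f k) (hfd k) k (by simpa [hf] using hcomp)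
  have hcont : ∀ v, Continuous fun x => fderiv ℝ φ (G x) v * (fderiv ℝ G x).det := fun v =>
    (((hφ.continuous_fderiv (by norm_num)).comp hG.continuous).clm_apply continuous_const).mul
      (ContinuousLinearMap.continuous_det.comp (hG.continuous_fderiv (by norm_num)))
  have hint : ∀ v, Integrable fun x => fderiv ℝ φ (G x) v * (fderiv ℝ G x).det := fun v => by
    refine (hcont v).integrable_of_hasCompactSupport (HasCompactSupport.intro hc fun x hx => ?_)
    rw [fderiv_of_notMem_tsupport ℝ hx]
    simp
  have hsum : ∀ x, fderiv ℝ φ (G x) w * (fderiv ℝ G x).det =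
      ∑ k, w k * (fderiv ℝ φ (G x) (Pi.single k 1) * (fderiv ℝ G x).det) := by
    intro x
    conv_lhs => rw [pi_eq_sum_univ' w, map_sum, Finset.sum_mul]
    refine Finset.sum_congr rfl fun k _ => ?_
    rw [map_smul, smul_eq_mul, mul_assoc]
  simp_rw [hsum]
  rw [integral_finsetSum _ fun k _ => (hint _).const_mul _]
  simp_rw [integral_const_mul, hzero, mul_zero, Finset.sum_const_zero]

open scoped NNReal Convolution in
/-- Mollification of a Lipschitz map: it keeps the Lipschitz constant and the derivative at points
around which the map is affine. -/
lemma LipschitzWith.exists_contDiff_approx {E E' : Type*} [NormedAddCommGroup E]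
    [NormedSpace ℝ E] [FiniteDimensional ℝ E] [NormedAddCommGroup E'] [NormedSpace ℝ E']
    [CompleteSpace E'] {F : E → E'} {L : ℝ≥0} (hF : LipschitzWith L F) {ε : ℝ} (hε : 0 < ε) :
    ∃ G : E → E', ContDiff ℝ 2 G ∧ LipschitzWith L G ∧ (∀ x, dist (G x) (F x) ≤ L * ε) ∧
      ∀ x (A : E →L[ℝ] E'), (∀ z ∈ Metric.ball x (2 * ε), F z = F x + A (z - x)) →
        HasFDerivAt G A x := by
  borelize E
  set μ : Measure E := Measure.addHaar
  set φ : ContDiffBump (0 : E) := ⟨ε / 2, ε, half_pos hε, half_lt_self hε⟩ with hφ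
  set G : E → E' := φ.normed μ ⋆[ContinuousLinearMap.lsmul ℝ ℝ, μ] F with hG
  have hGx : ∀ x, G x = ∫ t, φ.normed μ t • F (x - t) ∂μ := fun x => rfl
  have hint : ∀ x, Integrable (fun t => φ.normed μ t • F (x - t)) μ := fun x =>
    (φ.continuous_normed.smul (hF.continuous.comp (by fun_prop))).integrable_of_hasCompactSupport
      φ.hasCompactSupport_normed.smul_right
  have hsub : ∀ x z, G z - G x = ∫ t, φ.normed μ t • (F (z - t) - F (x - t)) ∂μ := by
    intro x z
    simp_rw [hGx, smul_sub]
    exact (integral_sub (hint z) (hint x)).symm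
  refine ⟨G, ?_, ?_, ?_, ?_⟩
  · exact φ.hasCompactSupport_normed.contDiff_convolution_left (n := 2) _ φ.contDiff_normed
      hF.continuous.locallyIntegrable
  · refine LipschitzWith.of_dist_le_mul fun z x => ?_
    rw [dist_eq_norm, hsub]
    calc _ ≤ ∫ t, φ.normed μ t * (L * dist z x) ∂μ := by
          refine norm_integral_le_of_norm_le (φ.integrable_normed.mul_const _) (ae_of_all _ ?_)
          intro t
          rw [norm_smul, Real.norm_of_nonneg (φ.nonneg_normed t), ← dist_eq_norm]
          refine mul_le_mul_of_nonneg_left ((hF.dist_le_mul _ _).trans ?_) (φ.nonneg_normed t)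
          rw [dist_sub_right]
      _ = L * dist z x := by rw [integral_mul_const, φ.integral_normed, one_mul]
  · refine fun x => φ.dist_normed_convolution_le hF.continuous.aestronglyMeasurable fun z hz => ?_
    exact (hF.dist_le_mul _ _).trans (mul_le_mul_of_nonneg_left (Metric.mem_ball.1 hz).le L.2)
  · intro x A hA
    have haff : ∀ᶠ z in 𝓝 x, G z = G x + A (z - x) := by
      filter_upwards [Metric.ball_mem_nhds x hε] with z hz
      rw [← sub_eq_iff_eq_add', hsub]
      calc _ = ∫ t, φ.normed μ t • A (z - x) ∂μ := by
            refine integral_congr_ae (ae_of_all _ fun t => ?_)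
            by_cases ht : t ∈ Metric.ball 0 ε
            · have hz' : ‖z - x‖ < ε := by simpa [dist_eq_norm] using hz
              have ht' : ‖t‖ < ε := by simpa using ht
              have h1 : z - t ∈ Metric.ball x (2 * ε) := by
                rw [Metric.mem_ball, dist_eq_norm]
                calc ‖z - t - x‖ = ‖(z - x) - t‖ := by congr 1; abel
                  _ ≤ ‖z - x‖ + ‖t‖ := _root_.norm_sub_le _ _
                  _ < 2 * ε := by linarith
              have h2 : x - t ∈ Metric.ball x (2 * ε) := by
                rw [Metric.mem_ball, dist_eq_norm]
                simp only [sub_sub_cancel_left, norm_neg]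
                linarith
              simp only [hA _ h1, hA _ h2]
              congr 1
              rw [add_sub_add_left_eq_sub, ← map_sub]
              congr 1
              abel
            · have : φ.normed μ t = 0 := by
                rw [← Function.notMem_support, φ.support_normed_eq]
                exact ht
              simp [this]
        _ = A (z - x) := φ.integral_normed_smul μ _
    have : HasFDerivAt (fun z => G x + A (z - x)) A x := by
      have := (A.hasFDerivAt.comp x ((hasFDerivAt_id x).sub_const x)).const_add (G x)
      simpa using this
    exact this.congr_of_eventuallyEq haff

open scoped NNReal in
lemma LipschitzWith.integral_fderiv_mul_det_fderiv_eq_zero {ι : Type*} [Fintype ι]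
    {F : (ι → ℝ) → (ι → ℝ)} {L : ℝ≥0} (hF : LipschitzWith L F)
    (hproper : ∀ K, IsCompact K → IsCompact (F ⁻¹' K))
    (hloc : ∀ᵐ x, ∃ A : (ι → ℝ) →L[ℝ] (ι → ℝ), ∀ᶠ z in 𝓝 x, F z = F x + A (z - x))
    {φ : (ι → ℝ) → ℝ} (hφ : ContDiff ℝ 2 φ) (hc : HasCompactSupport φ) (w : ι → ℝ) :
    ∫ x, fderiv ℝ φ (F x) w * (fderiv ℝ F x).det = 0 := by
  set ε : ℕ → ℝ := fun m => 1 / ((m : ℝ) + 1) with hε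
  have hεpos : ∀ m, 0 < ε m := fun m => by positivity
  have hε1 : ∀ m, ε m ≤ 1 := fun m => by
    rw [hε, div_le_one (by positivity)]
    have : (0 : ℝ) ≤ m := m.cast_nonneg
    linarith
  have hε0 : Tendsto ε atTop (𝓝 0) := tendsto_one_div_add_atTop_nhds_zero_nat
  choose G hG2 hGL hGd hGA using fun m => hF.exists_contDiff_approx (hεpos m)
  set K := F ⁻¹' Metric.cthickening L (tsupport φ) with hK
  have hKc : IsCompact K := hproper _ hc.isCompact.cthickening
  have hGK : ∀ m, G m ⁻¹' tsupport φ ⊆ K := by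
    intro m x hx
    refine Metric.mem_cthickening_of_dist_le _ (G m x) _ _ hx ?_
    rw [dist_comm]
    exact (hGd m x).trans (mul_le_of_le_one_right L.2 (hε1 m))
  have hzero : ∀ m, ∫ x, fderiv ℝ φ (G m x) w * (fderiv ℝ (G m) x).det = 0 := fun m =>
    integral_fderiv_mul_det_fderiv_eq_zero_of_contDiff (G m) (hG2 m) φ hφ
      (hKc.of_isClosed_subset ((isClosed_tsupport φ).preimage (hG2 m).continuous) (hGK m)) w
  have hφ'c : Continuous fun z => fderiv ℝ φ z w :=
    (hφ.continuous_fderiv (by norm_num)).clm_apply continuous_const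
  obtain ⟨C, hC⟩ := hφ'c.bounded_above_of_compact_support (hc.fderiv_apply ℝ w)
  obtain ⟨D, hD⟩ := (isCompact_closedBall (0 : (ι → ℝ) →L[ℝ] (ι → ℝ))
    (L : ℝ)).exists_bound_of_continuousOn
    (f := fun A : (ι → ℝ) →L[ℝ] (ι → ℝ) => A.det) ContinuousLinearMap.continuous_det.continuousOn
  have hlim := tendsto_integral_of_dominated_convergence (μ := volume)
    (F := fun m x => fderiv ℝ φ (G m x) w * (fderiv ℝ (G m) x).det)
    (f := fun x => fderiv ℝ φ (F x) w * (fderiv ℝ F x).det)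
    (K.indicator fun _ => C * D) ?_ ?_ ?_ ?_
  · simp_rw [hzero] at hlim
    exact tendsto_nhds_unique hlim tendsto_const_nhds
  · intro m
    exact ((hφ'c.comp (hG2 m).continuous).mul (ContinuousLinearMap.continuous_det.comp
      ((hG2 m).continuous_fderiv (by norm_num)))).aestronglyMeasurable
  · exact (integrable_indicator_iff hKc.measurableSet).2
      (integrableOn_const hKc.measure_ne_top)
  · refine fun m => ae_of_all _ fun x => ?_
    by_cases hx : x ∈ K
    · rw [indicator_of_mem hx, norm_mul]
      have hD' := hD (fderiv ℝ (G m) x) (by simpa using norm_fderiv_le_of_lipschitz ℝ (hGL m))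
      exact mul_le_mul (hC _) hD' (norm_nonneg _) ((norm_nonneg _).trans (hC 0))
    · rw [indicator_of_notMem hx, fderiv_of_notMem_tsupport ℝ fun h => hx (hGK m h)]
      simp
  · filter_upwards [hloc] with x ⟨A, hA⟩
    have hFA : HasFDerivAt F A x := by
      have : HasFDerivAt (fun z => F x + A (z - x)) A x := by
        have := (A.hasFDerivAt.comp x ((hasFDerivAt_id x).sub_const x)).const_add (F x)
        simpa using this
      exact this.congr_of_eventuallyEq hA
    obtain ⟨δ, hδ, hball⟩ := Metric.eventually_nhds_iff_ball.1 hA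
    have hev : ∀ᶠ m in atTop, fderiv ℝ (G m) x = fderiv ℝ F x := by
      filter_upwards [hε0.eventually_lt_const (half_pos hδ)] with m hm
      rw [hFA.fderiv]
      exact (hGA m x A fun z hz => hball z (Metric.ball_subset_ball (by linarith) hz)).fderiv
    have hGx : Tendsto (fun m => G m x) atTop (𝓝 (F x)) := by
      rw [tendsto_iff_dist_tendsto_zero]
      refine squeeze_zero (fun m => dist_nonneg) (fun m => hGd m x) ?_
      simpa using hε0.const_mul (L : ℝ)
    refine ((hφ'c.tendsto _).comp hGx).mul (tendsto_const_nhds.congr' ?_)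
    filter_upwards [hev] with m hm
    rw [hm]

open scoped NNReal in
/-- The integral representing the degree does not change when the test function is translated. -/
lemma LipschitzWith.integral_comp_sub_mul_det_fderiv {ι : Type*} [Fintype ι]
    {F : (ι → ℝ) → (ι → ℝ)} {L : ℝ≥0} (hF : LipschitzWith L F)
    (hproper : ∀ K, IsCompact K → IsCompact (F ⁻¹' K))
    (hloc : ∀ᵐ x, ∃ A : (ι → ℝ) →L[ℝ] (ι → ℝ), ∀ᶠ z in 𝓝 x, F z = F x + A (z - x))
    {φ : (ι → ℝ) → ℝ} (hφ : ContDiff ℝ 2 φ) (hc : HasCompactSupport φ) (y y' : ι → ℝ) :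
    ∫ x, φ (F x - y) * (fderiv ℝ F x).det = ∫ x, φ (F x - y') * (fderiv ℝ F x).det := by
  set w := y' - y with hw
  set g : ℝ → ℝ := fun t => ∫ x, φ (F x - (y + t • w)) * (fderiv ℝ F x).det with hg
  suffices h : ∀ t, HasDerivAt g 0 t by
    have := is_const_of_deriv_eq_zero (fun t => (h t).differentiableAt) (fun t => (h t).deriv) 0 1
    simpa [hg, hw] using this
  intro t₀
  have hdetm : AEStronglyMeasurable (fun x => (fderiv ℝ F x).det) :=
    (ContinuousLinearMap.continuous_det.measurable.comp
      (measurable_fderiv ℝ F)).aestronglyMeasurable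
  have hφ'c : Continuous fun z => fderiv ℝ φ z w :=
    (hφ.continuous_fderiv (by norm_num)).clm_apply continuous_const
  obtain ⟨C, hC⟩ := hφ'c.bounded_above_of_compact_support (hc.fderiv_apply ℝ w)
  obtain ⟨C₀, hC₀⟩ := hφ.continuous.bounded_above_of_compact_support hc
  obtain ⟨D, hD⟩ := (isCompact_closedBall (0 : (ι → ℝ) →L[ℝ] (ι → ℝ))
    (L : ℝ)).exists_bound_of_continuousOn
    (f := fun A : (ι → ℝ) →L[ℝ] (ι → ℝ) => A.det) ContinuousLinearMap.continuous_det.continuousOn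
  have hDx : ∀ x, ‖(fderiv ℝ F x).det‖ ≤ D := fun x =>
    hD _ (by simpa using norm_fderiv_le_of_lipschitz ℝ hF)
  set R : ℝ := ‖y‖ + (|t₀| + 1) * ‖w‖ with hR
  set K := F ⁻¹' Metric.cthickening R (tsupport φ) with hK
  have hKc : IsCompact K := hproper _ hc.isCompact.cthickening
  have hmem : ∀ x t, t ∈ Metric.ball t₀ 1 → F x - (y + t • w) ∈ tsupport φ → x ∈ K := by
    intro x t ht hx
    refine mem_preimage.2 (Metric.mem_cthickening_of_dist_le (F x) (F x - (y + t • w)) R _ hx ?_)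
    rw [dist_eq_norm, sub_sub_cancel]
    have hle : ‖y + t • w‖ ≤ ‖y‖ + ‖t‖ * ‖w‖ := (norm_add_le _ _).trans_eq (by rw [norm_smul])
    refine hle.trans (add_le_add le_rfl ?_)
    refine mul_le_mul_of_nonneg_right ?_ (norm_nonneg _)
    rw [Metric.mem_ball, Real.dist_eq] at ht
    have := abs_sub_abs_le_abs_sub t t₀
    rw [Real.norm_eq_abs]
    linarith
  have hzero : ∫ x, -(fderiv ℝ φ (F x - (y + t₀ • w)) w) * (fderiv ℝ F x).det = 0 := by
    have h := hF.integral_fderiv_mul_det_fderiv_eq_zero hproper hloc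
      (φ := fun z => φ (z - (y + t₀ • w))) (hφ.comp (contDiff_id.sub contDiff_const))
      (hc.comp_homeomorph (Homeomorph.subRight _)) w
    simp_rw [fderiv_comp_sub] at h
    simp_rw [neg_mul, integral_neg, h, neg_zero]
  have hcont : ∀ t : ℝ, Continuous fun x => F x - (y + t • w) := fun t =>
    hF.continuous.sub continuous_const
  rw [← hzero]
  refine (hasDerivAt_integral_of_dominated_loc_of_deriv_le (Metric.ball_mem_nhds t₀ one_pos)
    (bound := K.indicator fun _ => C * D)
    (F' := fun t x => -(fderiv ℝ φ (F x - (y + t • w)) w) * (fderiv ℝ F x).det)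
    (Eventually.of_forall fun t => ?_) ?_ ?_ ?_ ?_ ?_).2
  · exact (hφ.continuous.comp (hcont t)).aestronglyMeasurable.mul hdetm
  · refine Integrable.mono' ((integrable_indicator_iff hKc.measurableSet).2
      (integrableOn_const (C := C₀ * D) hKc.measure_ne_top))
      ((hφ.continuous.comp (hcont t₀)).aestronglyMeasurable.mul hdetm) (ae_of_all _ fun x => ?_)
    by_cases hx : x ∈ K
    · rw [indicator_of_mem hx, norm_mul]
      exact mul_le_mul (hC₀ _) (hDx x) (norm_nonneg _) ((norm_nonneg _).trans (hC₀ 0))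
    · rw [indicator_of_notMem hx, image_eq_zero_of_notMem_tsupport fun h =>
        hx (hmem x t₀ (Metric.mem_ball_self one_pos) h)]
      simp
  · exact (hφ'c.comp (hcont t₀)).neg.aestronglyMeasurable.mul hdetm
  · refine ae_of_all _ fun x t ht => ?_
    by_cases hx : x ∈ K
    · rw [indicator_of_mem hx, norm_mul, norm_neg]
      exact mul_le_mul (hC _) (hDx x) (norm_nonneg _) ((norm_nonneg _).trans (hC 0))
    · rw [indicator_of_notMem hx, fderiv_of_notMem_tsupport ℝ fun h => hx (hmem x t ht h)]
      simp
  · exact (integrable_indicator_iff hKc.measurableSet).2 (integrableOn_const hKc.measure_ne_top)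
  · refine ae_of_all _ fun x t _ => HasDerivAt.mul_const ?_ _
    have h1 : HasDerivAt (fun t : ℝ => F x - (y + t • w)) (-w) t := by
      simpa using (((hasDerivAt_id t).smul_const w).const_add y).const_sub (F x)
    have h2 := (hφ.differentiable (by norm_num) (F x - (y + t • w)))
      |>.hasFDerivAt.comp_hasDerivAt t h1
    rw [map_neg] at h2
    exact h2

/-- Linear change of variables. -/
lemma integral_comp_clm_sub_mul_det {E : Type*} [NormedAddCommGroup E] [NormedSpace ℝ E]
    [FiniteDimensional ℝ E] [MeasurableSpace E] [BorelSpace E] (μ : Measure E)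
    [μ.IsAddHaarMeasure] (A : E →L[ℝ] E) (hA : A.det ≠ 0) {φ : E → ℝ} (hφ : Continuous φ)
    (x : E) :
    ∫ z, φ (A (z - x)) * A.det ∂μ = Real.sign A.det * ∫ z, φ z ∂μ := by
  rw [integral_mul_const, integral_sub_right_eq_self (fun z => φ (A z)) x]
  have h1 : ∫ z, φ (A z) ∂μ = ∫ z, φ z ∂(Measure.map A μ) :=
    (integral_map A.continuous.aemeasurable hφ.aestronglyMeasurable).symm
  have h2 : Measure.map A μ = ENNReal.ofReal |A.det⁻¹| • μ :=
    Measure.map_linearMap_addHaar_eq_smul_addHaar μ hA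
  rw [h1, h2, integral_smul_measure, ENNReal.toReal_ofReal (abs_nonneg _), smul_eq_mul, abs_inv]
  have h3 : Real.sign A.det * |A.det| = A.det := by
    rcases hA.lt_or_gt with h | h
    · rw [Real.sign_of_neg h, abs_of_neg h]; ring
    · rw [Real.sign_of_pos h, abs_of_pos h]; ring
  have h4 : |A.det| ≠ 0 := abs_ne_zero.2 hA
  nth_rewrite 2 [← h3]
  field_simp

/-- If a proper map is affine and nonsingular around each of the finitely many preimages of `y`,
then its signed preimage count at `y` is computed by integrating against test functions. -/
lemma IsProperMap.exists_integral_eq_degSum_mul {n : ℕ} {F : (Fin n → ℝ) → (Fin n → ℝ)}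
    (hF : IsProperMap F) {y : Fin n → ℝ} (hfin : (F ⁻¹' {y}).Finite)
    (hdet : ∀ x, F x = y → (fderiv ℝ F x).det ≠ 0)
    (hloc : ∀ x, F x = y → ∀ᶠ z in 𝓝 x, F z = F x + fderiv ℝ F x (z - x)) :
    ∃ r > 0, ∀ φ : (Fin n → ℝ) → ℝ, Continuous φ → HasCompactSupport φ →
      (∀ z, φ z ≠ 0 → ‖z‖ < r) →
      ∫ x, φ (F x - y) * (fderiv ℝ F x).det = degSum F y * ∫ z, φ z := by
  obtain ⟨U, hU, hdisj⟩ := hfin.t2_separation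
  set V : (Fin n → ℝ) → Set (Fin n → ℝ) := fun x =>
    U x ∩ interior {z | F z = F x + fderiv ℝ F x (z - x)} with hV
  have hVo : ∀ x, IsOpen (V x) := fun x => (hU x).2.inter isOpen_interior
  have hxV : ∀ x, F x = y → x ∈ V x := fun x hx =>
    ⟨(hU x).1, mem_interior_iff_mem_nhds.2 (hloc x hx)⟩
  set s := hfin.toFinset with hs
  have hmems : ∀ x, x ∈ s ↔ F x = y := fun x => by simp [hs]
  set C : Set (Fin n → ℝ) := (⋃ x ∈ s, V x)ᶜ with hC
  have hCc : IsClosed (F '' C) :=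
    hF.isClosedMap _ (isOpen_biUnion fun x _ => hVo x).isClosed_compl
  have hyC : y ∉ F '' C := by
    rintro ⟨x, hx, rfl⟩
    exact hx (mem_biUnion ((hmems x).2 rfl) (hxV x rfl))
  have hsmall : ∀ᶠ v in 𝓝 (0 : Fin n → ℝ), y + v ∉ F '' C ∧
      ∀ x ∈ s, ∀ u, fderiv ℝ F x u = v → x + u ∈ V x := by
    refine Eventually.and ?_ ((Finset.eventually_all s).2 fun x hx => ?_)
    · have : Tendsto (fun v => y + v) (𝓝 0) (𝓝 y) :=
        (continuous_const.add continuous_id).tendsto' 0 y (by simp)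
      exact this.eventually (hCc.isOpen_compl.mem_nhds hyC)
    · rw [hmems] at hx
      set e := (fderiv ℝ F x).toContinuousLinearEquivOfDetNeZero (hdet x hx)
      have : Tendsto (fun v => x + e.symm v) (𝓝 0) (𝓝 x) :=
        (continuous_const.add e.symm.continuous).tendsto' 0 x (by simp)
      filter_upwards [this.eventually ((hVo x).mem_nhds (hxV x hx))] with v hv u hu
      rw [← hu] at hv
      have : e.symm (fderiv ℝ F x u) = u := e.symm_apply_apply u
      rwa [this] at hv
  obtain ⟨r, hr, hball⟩ := Metric.eventually_nhds_iff_ball.1 hsmall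
  refine ⟨r, hr, fun φ hφ hφc hφr => ?_⟩
  have hφb : ∀ z, φ z ≠ 0 → z ∈ Metric.ball 0 r := fun z hz => by simpa using hφr z hz
  have hterm : ∀ z, ∀ x ∈ s, φ (fderiv ℝ F x (z - x)) ≠ 0 → z ∈ V x := by
    intro z x hx h
    simpa using (hball _ (hφb _ h)).2 x hx (z - x) rfl
  have hpt : ∀ z, φ (F z - y) * (fderiv ℝ F z).det =
      ∑ x ∈ s, φ (fderiv ℝ F x (z - x)) * (fderiv ℝ F x).det := by
    intro z
    by_cases hz : z ∈ C
    · have h0 : φ (F z - y) = 0 := by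
        by_contra h
        refine (hball _ (hφb _ h)).1 ⟨z, hz, by abel⟩
      rw [h0, zero_mul, eq_comm]
      refine Finset.sum_eq_zero fun x hx => ?_
      have : φ (fderiv ℝ F x (z - x)) = 0 := by
        by_contra h
        exact hz (mem_biUnion hx (hterm z x hx h))
      rw [this, zero_mul]
    · rw [hC, notMem_compl_iff, mem_iUnion₂] at hz
      obtain ⟨x₀, hx₀, hz₀⟩ := hz
      rw [Finset.sum_eq_single_of_mem x₀ hx₀]
      · have h1 : F z - y = fderiv ℝ F x₀ (z - x₀) := by
          rw [interior_subset hz₀.2, (hmems x₀).1 hx₀, add_sub_cancel_left]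
        have h2 : fderiv ℝ F z = fderiv ℝ F x₀ := by
          have h3 : F =ᶠ[𝓝 z] fun z => F x₀ + fderiv ℝ F x₀ (z - x₀) :=
            mem_interior_iff_mem_nhds.1 hz₀.2
          rw [h3.fderiv_eq, fderiv_const_add]
          exact ((fderiv ℝ F x₀).hasFDerivAt.comp z ((hasFDerivAt_id z).sub_const x₀)).fderiv
        rw [h1, h2]
      · intro x hx hne
        have : φ (fderiv ℝ F x (z - x)) = 0 := by
          by_contra h
          exact (hdisj (by simpa [hs] using hx) (by simpa [hs] using hx₀) hne).le_bot
            ⟨(hterm z x hx h).1, hz₀.1⟩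
        rw [this, zero_mul]
  simp_rw [hpt]
  rw [integral_finsetSum]
  · rw [degSum, finsum_mem_eq_finite_toFinset_sum _ hfin, Finset.sum_mul]
    exact Finset.sum_congr rfl fun x hx =>
      integral_comp_clm_sub_mul_det volume _ (hdet x ((hmems x).1 hx)) hφ x
  · intro x hx
    set e := (fderiv ℝ F x).toContinuousLinearEquivOfDetNeZero (hdet x ((hmems x).1 hx))
    refine Integrable.mul_const ?_ _
    exact (hφ.comp ((fderiv ℝ F x).continuous.comp
      (continuous_id.sub continuous_const))).integrable_of_hasCompactSupport
      (hφc.comp_homeomorph ((Homeomorph.subRight x).trans e.toHomeomorph))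

lemma IsPolyhedron.convex {n : ℕ} {P : Set (Fin n → ℝ)} (hP : IsPolyhedron P) : Convex ℝ P := by
  obtain ⟨m, a, c, rfl⟩ := hP
  rw [ofPred_forall]
  refine convex_iInter fun i => ?_
  exact convex_halfSpace_le (f := fun x : Fin n → ℝ => ∑ j, a i j * x j)
    ⟨fun x z => by simp [mul_add, Finset.sum_add_distrib],
      fun t x => by simp [Finset.mul_sum, mul_left_comm]⟩ (c i)

lemma IsPolyhedron.isClosed {n : ℕ} {P : Set (Fin n → ℝ)} (hP : IsPolyhedron P) :
    IsClosed P := by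
  obtain ⟨m, a, c, rfl⟩ := hP
  rw [ofPred_forall]
  exact isClosed_iInter fun i => isClosed_le (by fun_prop) continuous_const

lemma affMap_eq_add {n : ℕ} (p : Matrix (Fin n) (Fin n) ℝ × (Fin n → ℝ)) (x z : Fin n → ℝ) :
    affMap p z = affMap p x + (Matrix.toLin' p.1).toContinuousLinearMap (z - x) := by
  simp only [affMap, LinearMap.coe_toContinuousLinearMap', Matrix.toLin'_apply,
    Matrix.mulVec_sub]
  abel

lemma continuous_affMap {n : ℕ} (p : Matrix (Fin n) (Fin n) ℝ × (Fin n → ℝ)) :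
    Continuous (affMap p) := by
  have h : affMap p =
      fun z => affMap p 0 + (Matrix.toLin' p.1).toContinuousLinearMap (z - 0) :=
    funext fun z => affMap_eq_add p 0 z
  rw [h]
  fun_prop

open scoped NNReal in
lemma IsPWA.exists_lipschitzWith {n : ℕ} {F : (Fin n → ℝ) → (Fin n → ℝ)}
    {S : Finset (Matrix (Fin n) (Fin n) ℝ × (Fin n → ℝ))} (hF : IsPWA F S) :
    ∃ L : ℝ≥0, LipschitzWith L F := by
  obtain ⟨hFc, hFS⟩ := hF
  set L : ℝ≥0 := S.sup fun p => ‖(Matrix.toLin' p.1).toContinuousLinearMap‖₊ with hL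
  have hLp : ∀ p ∈ S, ‖(Matrix.toLin' p.1).toContinuousLinearMap‖ ≤ L := fun p hp =>
    NNReal.coe_le_coe.2 (Finset.le_sup (f := fun p : Matrix (Fin n) (Fin n) ℝ × (Fin n → ℝ) =>
      ‖(Matrix.toLin' p.1).toContinuousLinearMap‖₊) hp)
  refine ⟨L, LipschitzWith.of_dist_le_mul fun y x => ?_⟩
  rw [dist_eq_norm, dist_eq_norm]
  set c : ℝ := L * ‖y - x‖ with hc
  set γ : ℝ → (Fin n → ℝ) := fun t => x + t • (y - x) with hγ
  have hγc : Continuous γ := by fun_prop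
  refine le_of_forall_pos_le_add fun η hη => ?_
  have key := image_norm_le_of_liminf_right_slope_norm_lt_deriv_boundary (a := 0) (b := 1)
    (f := fun t => F (γ t) - F x) (f' := fun _ => c) (B := fun t => (c + η) * t)
    (B' := fun _ => c + η) ((hFc.comp hγc).sub continuous_const).continuousOn ?_
    (by simp [hγ]) (by fun_prop) ?_ (fun _ _ _ => by linarith)
    (right_mem_Icc.2 zero_le_one)
  · simpa [hγ] using key
  · intro t _ r hr
    have hfreq : ∃ p ∈ S, ∃ᶠ z in 𝓝[>] t, F (γ z) = affMap p (γ z) := by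
      by_contra! h
      obtain ⟨z, hz⟩ := ((Finset.eventually_all S).2 h).exists
      obtain ⟨p, hp, hpz⟩ := hFS (γ z)
      exact hz p hp hpz
    obtain ⟨p, hp, hfreq⟩ := hfreq
    have ht : F (γ t) = affMap p (γ t) := by
      have hcl : IsClosed {z | F (γ z) = affMap p (γ z)} :=
        isClosed_eq (hFc.comp hγc) ((continuous_affMap p).comp hγc)
      exact hcl.mem_of_frequently_of_tendsto hfreq nhdsWithin_le_nhds
    refine (hfreq.and_eventually self_mem_nhdsWithin).mono fun z ⟨hz, htz⟩ => ?_
    have htz' : 0 < z - t := sub_pos.2 htz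
    refine lt_of_le_of_lt ?_ hr
    rw [slope_def_field, div_le_iff₀ htz']
    calc ‖F (γ z) - F x‖ - ‖F (γ t) - F x‖ ≤ ‖(F (γ z) - F x) - (F (γ t) - F x)‖ :=
          norm_sub_norm_le _ _
      _ = ‖(Matrix.toLin' p.1).toContinuousLinearMap (γ z - γ t)‖ := by
          rw [sub_sub_sub_cancel_right, hz, ht, affMap_eq_add p (γ t) (γ z), add_sub_cancel_left]
      _ ≤ L * ‖γ z - γ t‖ := ContinuousLinearMap.le_of_opNorm_le _ (hLp p hp) _
      _ = c * (z - t) := by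
          simp only [hγ, add_sub_add_left_eq_sub, ← sub_smul, norm_smul,
            Real.norm_of_nonneg htz'.le, hc]
          ring
  · intro t _
    simpa using ((hasDerivAt_id t).const_mul (c + η)).hasDerivWithinAt

lemma IsSubdivision.isProperMap {n : ℕ} {F : (Fin n → ℝ) → (Fin n → ℝ)}
    {S : Finset (Matrix (Fin n) (Fin n) ℝ × (Fin n → ℝ))} {𝒞 : Set (Set (Fin n → ℝ))}
    (h𝒞 : IsSubdivision F S 𝒞) (hF : Continuous F) (hns : NonsingularAtInfinity F S 𝒞) :
    IsProperMap F := by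
  obtain ⟨hfin, -, hcov, hact, -⟩ := h𝒞
  refine isProperMap_iff_isCompact_preimage.2 ⟨hF, fun K hK => ?_⟩
  refine Metric.isCompact_of_isClosed_isBounded (hK.isClosed.preimage hF) ?_
  have hsub : F ⁻¹' K ⊆ ⋃ P ∈ 𝒞, P ∩ F ⁻¹' K := by
    intro x hx
    obtain ⟨P, hP, hxP⟩ := mem_sUnion.1 (hcov ▸ mem_univ x : x ∈ ⋃₀ 𝒞)
    exact mem_biUnion hP ⟨hxP, hx⟩
  refine ((isBounded_biUnion hfin).2 fun P hP => ?_).subset hsub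
  by_cases hb : IsBounded P
  · exact hb.subset inter_subset_left
  · obtain ⟨p, hpS, hp⟩ := hact P hP
    have hdet : (Matrix.toLin' p.1).toContinuousLinearMap.det ≠ 0 := by
      simpa [ContinuousLinearMap.det] using hns p hpS P hP hb hp
    set e := (Matrix.toLin' p.1).toContinuousLinearMap.toContinuousLinearEquivOfDetNeZero hdet
    have hcomp : IsCompact ((fun v => e.symm (v - affMap p 0)) '' K) :=
      hK.image (e.symm.continuous.comp (continuous_id.sub continuous_const))
    refine hcomp.isBounded.subset ?_
    rintro x ⟨hxP, hxK⟩
    refine ⟨F x, hxK, ?_⟩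
    have h : F x - affMap p 0 = e x := by
      rw [hp x hxP, affMap_eq_add p 0 x, add_sub_cancel_left, sub_zero]
      rfl
    simp only [h, e.symm_apply_apply]

lemma IsSubdivision.ae_eventually_eq_affine {n : ℕ} {F : (Fin n → ℝ) → (Fin n → ℝ)}
    {S : Finset (Matrix (Fin n) (Fin n) ℝ × (Fin n → ℝ))} {𝒞 : Set (Set (Fin n → ℝ))}
    (h𝒞 : IsSubdivision F S 𝒞) :
    ∀ᵐ x, ∃ A : (Fin n → ℝ) →L[ℝ] (Fin n → ℝ), ∀ᶠ z in 𝓝 x, F z = F x + A (z - x) := by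
  obtain ⟨hfin, hpoly, hcov, hact, -⟩ := h𝒞
  have hnull : ∀ᵐ x, ∀ P ∈ 𝒞, x ∉ frontier P := by
    refine (ae_ball_iff hfin.countable).2 fun P hP => ?_
    exact measure_eq_zero_iff_ae_notMem.1 ((hpoly P hP).1.convex.addHaar_frontier volume)
  filter_upwards [hnull] with x hx
  obtain ⟨P, hP, hxP⟩ := mem_sUnion.1 (hcov ▸ mem_univ x : x ∈ ⋃₀ 𝒞)
  obtain ⟨p, -, hp⟩ := hact P hP
  have hxint : x ∈ interior P := by
    by_contra h
    exact hx P hP ⟨subset_closure hxP, h⟩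
  refine ⟨(Matrix.toLin' p.1).toContinuousLinearMap, ?_⟩
  filter_upwards [mem_interior_iff_mem_nhds.1 hxint] with z hz
  rw [hp z hz, hp x hxP, affMap_eq_add p x z]

/-- On each polyhedron containing a point of differentiability, `F` is given by its derivative. -/
lemma IsSubdivision.eq_add_fderiv_of_mem {n : ℕ} {F : (Fin n → ℝ) → (Fin n → ℝ)}
    {S : Finset (Matrix (Fin n) (Fin n) ℝ × (Fin n → ℝ))} {𝒞 : Set (Set (Fin n → ℝ))}
    (h𝒞 : IsSubdivision F S 𝒞) {x : Fin n → ℝ} (hx : DifferentiableAt ℝ F x)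
    {P : Set (Fin n → ℝ)} (hP : P ∈ 𝒞) (hxP : x ∈ P) {z : Fin n → ℝ} (hz : z ∈ P) :
    F z = F x + fderiv ℝ F x (z - x) := by
  obtain ⟨-, hpoly, -, hact, -⟩ := h𝒞
  obtain ⟨p, -, hp⟩ := hact P hP
  have hF : ∀ z ∈ P, F z = F x + (Matrix.toLin' p.1).toContinuousLinearMap (z - x) :=
    fun z hz => by rw [hp z hz, hp x hxP, affMap_eq_add p x z]
  have huniq : UniqueDiffWithinAt ℝ P x :=
    uniqueDiffWithinAt_convex (hpoly P hP).1.convex (hpoly P hP).2 (subset_closure hxP)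
  have h1 : HasFDerivWithinAt F (Matrix.toLin' p.1).toContinuousLinearMap P x := by
    have h2 := (((Matrix.toLin' p.1).toContinuousLinearMap.hasFDerivAt.comp x
      ((hasFDerivAt_id x).sub_const x)).const_add (F x)).hasFDerivWithinAt (s := P)
    exact h2.congr hF (hF x hxP)
  rw [huniq.eq hx.hasFDerivAt.hasFDerivWithinAt h1]
  exact hF z hz

lemma IsSubdivision.eventually_eq_add_fderiv {n : ℕ} {F : (Fin n → ℝ) → (Fin n → ℝ)}
    {S : Finset (Matrix (Fin n) (Fin n) ℝ × (Fin n → ℝ))} {𝒞 : Set (Set (Fin n → ℝ))}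
    (h𝒞 : IsSubdivision F S 𝒞) {x : Fin n → ℝ} (hx : DifferentiableAt ℝ F x) :
    ∀ᶠ z in 𝓝 x, F z = F x + fderiv ℝ F x (z - x) := by
  have hev : ∀ᶠ z in 𝓝 x, ∀ P ∈ 𝒞, z ∈ P → x ∈ P := by
    refine (eventually_all_finite h𝒞.1).2 fun P hP => ?_
    by_cases hxP : x ∈ P
    · exact Eventually.of_forall fun _ _ => hxP
    · filter_upwards [(h𝒞.2.1 P hP).1.isClosed.isOpen_compl.mem_nhds hxP] with z hz hzP
      exact absurd hzP hz
  filter_upwards [hev] with z hz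
  obtain ⟨P, hP, hzP⟩ := mem_sUnion.1 (h𝒞.2.2.1 ▸ mem_univ z : z ∈ ⋃₀ 𝒞)
  exact h𝒞.eq_add_fderiv_of_mem hx hP (hz P hP hzP) hzP

lemma IsSubdivision.finite_preimage {n : ℕ} {F : (Fin n → ℝ) → (Fin n → ℝ)}
    {S : Finset (Matrix (Fin n) (Fin n) ℝ × (Fin n → ℝ))} {𝒞 : Set (Set (Fin n → ℝ))}
    (h𝒞 : IsSubdivision F S 𝒞) {y : Fin n → ℝ} (hy : IsRegularValue F y) :
    (F ⁻¹' {y}).Finite := by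
  have hex : ∀ x, ∃ P ∈ 𝒞, x ∈ P := fun x =>
    mem_sUnion.1 (h𝒞.2.2.1 ▸ mem_univ x : x ∈ ⋃₀ 𝒞)
  choose P hP hxP using hex
  refine Finite.of_finite_image (f := P) (h𝒞.1.subset (image_subset_iff.2 fun x _ => hP x)) ?_
  intro x hx z hz hxz
  obtain ⟨hd, hdet⟩ := hy x hx
  have h := h𝒞.eq_add_fderiv_of_mem hd (hP x) (hxP x) (hxz ▸ hxP z : z ∈ P x)
  rw [show F z = y from hz, show F x = y from hx, left_eq_add] at h
  have h' : (fderiv ℝ F x).toContinuousLinearEquivOfDetNeZero hdet (z - x) = 0 := h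
  rw [map_eq_zero_iff _ (ContinuousLinearEquiv.injective _), sub_eq_zero] at h'
  exact h'.symm

/-- (Globally defined degree.) For a piecewise affine `F : ℝⁿ → ℝⁿ`
nonsingular at infinity w.r.t. a corresponding subdivision, any two regular values have
finite preimages and the same signed preimage count. -/
theorem degree_globally_defined
    {n : ℕ} (F : (Fin n → ℝ) → (Fin n → ℝ))
    (S : Finset (Matrix (Fin n) (Fin n) ℝ × (Fin n → ℝ)))
    (𝒞 : Set (Set (Fin n → ℝ)))
    (hF : IsPWA F S) (h𝒞 : IsSubdivision F S 𝒞)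
    (hns : NonsingularAtInfinity F S 𝒞)
    (y y' : Fin n → ℝ) (hy : IsRegularValue F y) (hy' : IsRegularValue F y') :
    (F ⁻¹' {y}).Finite ∧ (F ⁻¹' {y'}).Finite ∧ degSum F y = degSum F y' := by
  obtain ⟨L, hL⟩ := hF.exists_lipschitzWith
  have hproper := h𝒞.isProperMap hF.1 hns
  have hfin := h𝒞.finite_preimage hy
  have hfin' := h𝒞.finite_preimage hy'
  refine ⟨hfin, hfin', ?_⟩
  obtain ⟨r, hr, h⟩ := hproper.exists_integral_eq_degSum_mul hfin (fun x hx => (hy x hx).2)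
    fun x hx => h𝒞.eventually_eq_add_fderiv (hy x hx).1
  obtain ⟨r', hr', h'⟩ := hproper.exists_integral_eq_degSum_mul hfin' (fun x hx => (hy' x hx).2)
    fun x hx => h𝒞.eventually_eq_add_fderiv (hy' x hx).1
  have hρ : 0 < min r r' := lt_min hr hr'
  set φ : ContDiffBump (0 : Fin n → ℝ) := ⟨min r r' / 2, min r r', half_pos hρ, half_lt_self hρ⟩
  have hφ : ∀ z, φ z ≠ 0 → ‖z‖ < min r r' := fun z hz => by
    have : z ∈ Function.support φ := hz
    rw [φ.support_eq, Metric.mem_ball, dist_zero_right] at this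
    exact this
  have hpos : (0 : ℝ) < ∫ z, φ z := φ.integral_pos
  refine mul_right_cancel₀ hpos.ne' ?_
  rw [← h φ φ.continuous φ.hasCompactSupport fun z hz => (hφ z hz).trans_le (min_le_left _ _),
    ← h' φ φ.continuous φ.hasCompactSupport fun z hz => (hφ z hz).trans_le (min_le_right _ _)]
  exact hL.integral_comp_sub_mul_det_fderiv (fun K hK => hproper.isCompact_preimage hK)
    h𝒞.ae_eventually_eq_affine φ.contDiff φ.hasCompactSupport y y'
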